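/- Let G = (N, v) be a characteristic function game with |N| = n ≥ 2 and let i ∈ N be a dummy agent, i.e., v(C ∪ {i}) = v(C) for every C ⊆ N∖{i}. Then EV_i(G) = −v(N)/(n−1). -/

import Mathlib

open Finset

/-- The set of all permutations (encoded as lists) of the elements of a finset `s`.
For a nodup base list this is exactly the set `Π_s` of orderings of `s`. -/
noncomputable def permsOf {α : Type*} [DecidableEq α] (s : Finset α) : Finset (List α) :=
  s.toList.permutations.toFinset

/-- The Shapley Value of agent `i` in the characteristic function game on the
(full, finite) agent set `α` with characteristic function `v`:
`SV_i = (1/n!) ∑_{m=0}^{n-1} ∑_{π ∈ Π_{N∖{i}}} (v (S_π(m) ∪ {i}) - v (S_π(m)))`,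
where `S_π(m)` is the set of the first `m` entries of `π`. -/
noncomputable def ShapleyValue {α : Type*} [Fintype α] [DecidableEq α]
    (v : Finset α → ℝ) (i : α) : ℝ :=
  (((Fintype.card α).factorial : ℝ))⁻¹ *
    ∑ π ∈ permsOf (Finset.univ.erase i), ∑ m ∈ Finset.range (Fintype.card α),
      (v (insert i (π.take m).toFinset) - v (π.take m).toFinset)

/-- The Exchange Value of agent `i`:
`EV_i = (1/((n-1)!·(n-1))) ∑_{m=1}^{n-1} ∑_{π ∈ Π_{N∖{i}}} (v (S_π(m-1) ∪ {i}) - v (S_π(m)))`. -/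
noncomputable def ExchangeValue {α : Type*} [Fintype α] [DecidableEq α]
    (v : Finset α → ℝ) (i : α) : ℝ :=
  ((((Fintype.card α - 1).factorial * (Fintype.card α - 1) : ℕ) : ℝ))⁻¹ *
    ∑ π ∈ permsOf (Finset.univ.erase i), ∑ m ∈ Finset.Icc 1 (Fintype.card α - 1),
      (v (insert i (π.take (m - 1)).toFinset) - v (π.take m).toFinset)

theorem mem_permsOf {α : Type*} [DecidableEq α] {s : Finset α} {π : List α} :
    π ∈ permsOf s ↔ π.Perm s.toList := by
  simp [permsOf]

theorem card_permsOf {α : Type*} [DecidableEq α] (s : Finset α) :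
    (permsOf s).card = s.card.factorial := by
  rw [permsOf, List.toFinset_card_of_nodup (List.nodup_permutations _ s.nodup_toList),
    List.length_permutations, Finset.length_toList]

theorem toFinset_of_mem_permsOf {α : Type*} [DecidableEq α] {s : Finset α} {π : List α}
    (h : π ∈ permsOf s) : π.toFinset = s := by
  rw [List.toFinset_eq_of_perm _ _ (mem_permsOf.mp h), Finset.toList_toFinset]

theorem length_of_mem_permsOf {α : Type*} [DecidableEq α] {s : Finset α} {π : List α}
    (h : π ∈ permsOf s) : π.length = s.card := by
  rw [(mem_permsOf.mp h).length_eq, Finset.length_toList]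

/-- For a dummy agent, the exchange contributions along a fixed ordering telescope. -/
theorem sum_exchange_contribution_of_dummy {α : Type*} [DecidableEq α] {v : Finset α → ℝ}
    {i : α} (hdummy : ∀ C : Finset α, i ∉ C → v (insert i C) = v C) {π : List α} (hπ : i ∉ π)
    (k : ℕ) :
    ∑ m ∈ Finset.Icc 1 k, (v (insert i (π.take (m - 1)).toFinset) - v (π.take m).toFinset) =
      v ∅ - v (π.take k).toFinset := by
  induction k with
  | zero => simp
  | succ k ih =>
    have hi : i ∉ (π.take k).toFinset := fun h => hπ (List.mem_of_mem_take (List.mem_toFinset.mp h))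
    rw [Finset.sum_Icc_succ_top (by omega), ih, Nat.add_sub_cancel, hdummy _ hi]
    ring

/-- If `i` is a dummy agent, i.e. `v (C ∪ {i}) = v C` for every `C ⊆ N ∖ {i}`,
then `EV_i(G) = −v(N)/(n−1)`. -/
theorem exchangeValue_dummy
    {α : Type*} [Fintype α] [DecidableEq α]
    (hn : 2 ≤ Fintype.card α) (v : Finset α → ℝ) (hv : v ∅ = 0) (i : α)
    (hdummy : ∀ C : Finset α, i ∉ C → v (insert i C) = v C) :
    ExchangeValue v i = -(v Finset.univ) / ((Fintype.card α : ℝ) - 1) := by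
  have hcard : (Finset.univ.erase i).card = Fintype.card α - 1 := by
    rw [Finset.card_erase_of_mem (Finset.mem_univ i), Finset.card_univ]
  have hsum : ∀ π ∈ permsOf (Finset.univ.erase i),
      ∑ m ∈ Finset.Icc 1 (Fintype.card α - 1),
        (v (insert i (π.take (m - 1)).toFinset) - v (π.take m).toFinset) =
      -v Finset.univ := by
    intro π hπ
    have hset := toFinset_of_mem_permsOf hπ
    have hi : i ∉ π := by
      rw [← List.mem_toFinset, hset]
      exact Finset.notMem_erase i _
    rw [sum_exchange_contribution_of_dummy hdummy hi, hv,
      List.take_of_length_le ((length_of_mem_permsOf hπ).trans hcard).le, hset,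
      ← hdummy _ (Finset.notMem_erase i _), Finset.insert_erase (Finset.mem_univ i), zero_sub]
  have hpos : (Fintype.card α : ℝ) - 1 ≠ 0 := by
    have : (2 : ℝ) ≤ Fintype.card α := by exact_mod_cast hn
    linarith
  have hfact : ((Fintype.card α - 1).factorial : ℝ) ≠ 0 := by
    exact_mod_cast Nat.factorial_ne_zero _
  rw [ExchangeValue, Finset.sum_congr rfl hsum, Finset.sum_const, card_permsOf, hcard,
    nsmul_eq_mul, Nat.cast_mul, Nat.cast_sub (by omega : 1 ≤ Fintype.card α), Nat.cast_one]
  field_simp
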